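/- arXiv:2308.02456 — 3 statements merged into one kernel-verified Lean document; each statement's English description precedes it below -/
import Mathlib

section
/- Let N be an R-module and let M₁ and M₂ be RD-submodules of N. Then there exist submodules M₀ ⊆ M₁' of N such that: M₁ ⊆ M₁'; M₀ and M₁' are RD-submodules of N; M₀ is an RD-submodule of M₁' and M₀ ⊆ M₂ is an RD-submodule of M₂; the cardinality of M₀ is at most max(card(M₁), card(R), ℵ₀); and the canonical R-homomorphism t : (M₁' ⊕ M₂)/{(m, −m) : m ∈ M₀} → N given by [(x, y)] ↦ x + y is an RD-embedding. -/
universe u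

/-- `A` is an RD-submodule of its ambient module: for every `r : R`,
`A ∩ r • M = r • A`. -/
def IsRDSubmodule {R : Type*} [Ring R] {M : Type*} [AddCommGroup M] [Module R M]
    (A : Submodule R M) : Prop :=
  ∀ (r : R) (x : M), x ∈ A → (∃ b : M, r • b = x) → ∃ a : M, a ∈ A ∧ r • a = x

/-- An RD-embedding is an injective linear map whose image is an RD-submodule
of its codomain. -/
def IsRDEmbedding {R : Type*} [Ring R] {M N : Type*} [AddCommGroup M] [Module R M]
    [AddCommGroup N] [Module R N] (f : M →ₗ[R] N) : Prop :=
  Function.Injective f ∧ IsRDSubmodule (LinearMap.range f)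

/-- For submodules `P, Q, S` of a common ambient module with `S ≤ P` and `S ≤ Q`,
this is the submodule `{(m, -m) : m ∈ S}` of `P × Q` (described without using the
inequalities as `{(x, y) : x ∈ S, x + y = 0}`). -/
def amalgKer {R : Type*} [Ring R] {N : Type*} [AddCommGroup N] [Module R N]
    (P Q S : Submodule R N) : Submodule R (↥P × ↥Q) :=
  (S.comap (P.subtype.comp (LinearMap.fst R ↥P ↥Q))) ⊓
    LinearMap.ker (P.subtype.coprod Q.subtype)

/-- The canonical map `(P ⊕ Q)/{(m, -m) : m ∈ S} → N`, `[(x, y)] ↦ x + y`. -/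
def amalgMap {R : Type*} [Ring R] {N : Type*} [AddCommGroup N] [Module R N]
    (P Q S : Submodule R N) : ((↥P × ↥Q) ⧸ amalgKer P Q S) →ₗ[R] N :=
  Submodule.liftQ _ (P.subtype.coprod Q.subtype) inf_le_right

theorem exists_closed_set {R N : Type u} (op : R × ℕ → N → N → N) (z : N) (A : Set N) :
    ∃ S : Set N, A ⊆ S ∧ (∀ p x y, x ∈ S → y ∈ S → op p x y ∈ S) ∧
      Cardinal.mk S ≤ max (max (Cardinal.mk A) (Cardinal.mk R)) Cardinal.aleph0 := by
  let L : FirstOrder.Language.{u, u} := ⟨fun _ => R × ℕ, fun _ => PEmpty⟩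
  let _ : L.Structure N :=
    { funMap := fun {n} f v =>
        op f (if h : 0 < n then v ⟨0, h⟩ else z) (if h : 1 < n then v ⟨1, h⟩ else z)
      RelMap := fun {n} r _ => r.elim }
  refine ⟨(FirstOrder.Language.Substructure.closure L A : L.Substructure N),
    FirstOrder.Language.Substructure.subset_closure, ?_, ?_⟩
  · intro p x y hx hy
    have := (FirstOrder.Language.Substructure.closure L A).fun_mem (n := 2) p ![x, y] (by
      intro i
      fin_cases i
      · exact hx
      · exact hy)
    exact this
  · have h := FirstOrder.Language.Substructure.lift_card_closure_le (L := L) (s := A)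
    simp only [Cardinal.lift_id] at h
    refine h.trans (max_le (le_max_right _ _) ?_)
    refine (Cardinal.add_le_max _ _).trans (max_le (max_le ?_ ?_) (le_max_right _ _))
    · exact (le_max_left _ _).trans (le_max_left _ _)
    · have : Cardinal.mk (Σ i, L.Functions i) = Cardinal.aleph0 * (Cardinal.mk R * Cardinal.aleph0) := by
        change Cardinal.mk (Σ _ : ℕ, R × ℕ) = _
        simp
      rw [this]
      refine (Cardinal.mul_le_max _ _).trans (max_le (max_le (le_max_right _ _) ?_) (le_max_right _ _))
      refine (Cardinal.mul_le_max _ _).trans (max_le (max_le ?_ (le_max_right _ _)) (le_max_right _ _))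
      exact (le_max_right _ _).trans (le_max_left _ _)

theorem stmt6 {R N : Type u} [Ring R] [AddCommGroup N] [Module R N]
    (M₁ M₂ : Submodule R N) (h₁ : IsRDSubmodule M₁) (h₂ : IsRDSubmodule M₂) :
    ∃ M₀ M₁' : Submodule R N,
      -- `M₀ ⊆ M₁'` and `M₁ ⊆ M₁'` and `M₀ ⊆ M₂`
      M₀ ≤ M₁' ∧ M₁ ≤ M₁' ∧ M₀ ≤ M₂ ∧
      -- `M₀` and `M₁'` are RD-submodules of `N`
      IsRDSubmodule M₀ ∧ IsRDSubmodule M₁' ∧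
      -- `M₀` is an RD-submodule of `M₁'` and of `M₂`
      IsRDSubmodule (M₀.comap M₁'.subtype) ∧
      IsRDSubmodule (M₀.comap M₂.subtype) ∧
      -- `card M₀ ≤ max (card M₁) (card R) ℵ₀`
      Cardinal.mk ↥M₀ ≤ max (max (Cardinal.mk ↥M₁) (Cardinal.mk R)) Cardinal.aleph0 ∧
      -- the canonical map `t : (M₁' ⊕ M₂)/{(m, -m) : m ∈ M₀} → N`, `[(x,y)] ↦ x + y`,
      -- is an RD-embedding
      IsRDEmbedding (amalgMap M₁' M₂ M₀) := by
  classical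
  let f : R → N → N := fun r x => if h : ∃ b, r • b = x then h.choose else 0
  let g : R → N → N := fun r x => if h : ∃ b, b ∈ M₂ ∧ r • b = x then h.choose else 0
  let k : R → N → N := fun r x => if h : ∃ b, r • b - x ∈ M₂ then h.choose else 0
  have hf : ∀ r x, (∃ b, r • b = x) → r • f r x = x := fun r x h => by
    simp only [f, dif_pos h]; exact h.choose_spec
  have hg : ∀ r x, (∃ b, b ∈ M₂ ∧ r • b = x) → g r x ∈ M₂ ∧ r • g r x = x := fun r x h => by
    simp only [g, dif_pos h]; exact h.choose_spec
  have hk : ∀ r x, (∃ b, r • b - x ∈ M₂) → r • k r x - x ∈ M₂ := fun r x h => by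
    simp only [k, dif_pos h]; exact h.choose_spec
  let op : R × ℕ → N → N → N := fun p x y => match p.2 with
    | 0 => p.1 • x
    | 1 => x + y
    | 2 => f p.1 x
    | 3 => g p.1 x
    | _ => k p.1 x
  obtain ⟨S, hS, hop, hcard⟩ := exists_closed_set op 0 (M₁ : Set N)
  let X : Submodule R N :=
    { carrier := S
      add_mem' := fun {x y} hx hy => hop (0, 1) x y hx hy
      zero_mem' := hS M₁.zero_mem
      smul_mem' := fun r x hx => hop (r, 0) x x hx hx }
  have Xf : ∀ r x, x ∈ X → f r x ∈ X := fun r x hx => hop (r, 2) x x hx hx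
  have Xg : ∀ r x, x ∈ X → g r x ∈ X := fun r x hx => hop (r, 3) x x hx hx
  have Xk : ∀ r x, x ∈ X → k r x ∈ X := fun r x hx => hop (r, 4) x x hx hx
  have h0 : IsRDSubmodule (X ⊓ M₂) := by
    rintro r x ⟨hx, hx2⟩ hb
    obtain ⟨h3, h4⟩ := hg r x (h₂ r x hx2 hb)
    exact ⟨_, ⟨Xg r x hx, h3⟩, h4⟩
  have hcomap : ∀ Q : Submodule R N, X ⊓ M₂ ≤ Q →
      IsRDSubmodule ((X ⊓ M₂).comap Q.subtype) := by
    rintro Q hQ r x hx ⟨b, rfl⟩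
    obtain ⟨a, ha, hab⟩ := h0 r (r • (b : N)) hx ⟨b, rfl⟩
    exact ⟨⟨a, hQ ha⟩, ha, Subtype.ext hab⟩
  refine ⟨X ⊓ M₂, X, inf_le_left, hS, inf_le_right, h0, ?_, hcomap _ inf_le_left,
    hcomap _ inf_le_right, ?_, ?_, ?_⟩
  · intro r x hx hb
    exact ⟨_, Xf r x hx, hf r x hb⟩
  · exact (Cardinal.mk_le_mk_of_subset (fun x hx => hx.1 : ((X ⊓ M₂ : Submodule R N) : Set N) ⊆ S)).trans hcard
  · rw [← LinearMap.ker_eq_bot]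
    refine Submodule.ker_liftQ_eq_bot _ _ _ ?_
    rintro ⟨⟨x, hx⟩, ⟨y, hy⟩⟩ h
    refine ⟨?_, h⟩
    have h' : x + y = 0 := h
    refine ⟨hx, ?_⟩
    change x ∈ M₂
    rw [eq_neg_of_add_eq_zero_left h']
    exact M₂.neg_mem hy
  · have hr : LinearMap.range (amalgMap X M₂ (X ⊓ M₂)) = X ⊔ M₂ := by
      refine (Submodule.range_liftQ _ _ _).trans ?_
      rw [LinearMap.range_coprod, Submodule.range_subtype,
        Submodule.range_subtype]
    rw [hr]
    rintro r z hz ⟨b, rfl⟩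
    obtain ⟨x, hx, m, hm, hxm⟩ := Submodule.mem_sup.1 hz
    have hb : r • b - x ∈ M₂ := by rw [← hxm]; simpa using hm
    have hk' := hk r x ⟨b, hb⟩
    have hd : r • (b - k r x) ∈ M₂ := by
      have := M₂.sub_mem hb hk'
      rwa [sub_sub_sub_cancel_right, ← smul_sub] at this
    obtain ⟨a, ha, hab⟩ := h₂ r _ hd ⟨_, rfl⟩
    refine ⟨k r x + a, Submodule.add_mem_sup (Xk r x hx) ha, ?_⟩
    rw [smul_add, hab, smul_sub]; abel
end

section
/- Let M₀, M₁, M₂ be pure submodules of an R-module M₃ with M₀ ⊆ M₁ and M₀ ⊆ M₂, where M₀ is a pure submodule of both M₁ and M₂. Suppose that for every finite subset D of M₂ there exist R-modules L₁, L₂, L₃ such that: M₃ is a pure submodule of L₃; L₁ and L₂ are pure submodules of L₃ with M₁ ⊆ L₁, D ⊆ L₂ and M₀ a pure submodule of both L₁ and L₂; and the canonical R-homomorphism (L₁ ⊕ L₂)/{(m, −m) : m ∈ M₀} → L₃ given by [(x, y)] ↦ x + y is a pure embedding. Then the canonical R-homomorphism t : (M₁ ⊕ M₂)/{(m, −m)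 : m ∈ M₀} → M₃ given by [(x, y)] ↦ x + y is a pure embedding. -/
universe u

/-- `A` is a pure submodule of its ambient module: every finite system of
`R`-linear equations `∑ j, r i j • x j = a i` with constants `a i ∈ A` that has
a solution in the ambient module has a solution in `A`. -/
def IsPureSubmodule {R : Type*} [Ring R] {M : Type*} [AddCommGroup M] [Module R M]
    (A : Submodule R M) : Prop :=
  ∀ (m n : ℕ) (r : Fin m → Fin n → R) (a : Fin m → M),
    (∀ i, a i ∈ A) →
    (∃ x : Fin n → M, ∀ i, (∑ j, r i j • x j) = a i) →
    ∃ x : Fin n → M, (∀ j, x j ∈ A) ∧ ∀ i, (∑ j, r i j • x j) = a i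

/-- A pure embedding is an injective linear map whose image is a pure submodule
of its codomain. -/
def IsPureEmbedding {R : Type*} [Ring R] {M N : Type*} [AddCommGroup M] [Module R M]
    [AddCommGroup N] [Module R N] (f : M →ₗ[R] N) : Prop :=
  Function.Injective f ∧ IsPureSubmodule (LinearMap.range f)

/-- A witness for the finite subset `D` of `M₂`: modules `L₃` (here `L`),
a pure embedding `e : M₃ → L₃`, and pure submodules `L₁, L₂` of `L₃` with
`M₁ ⊆ L₁`, `D ⊆ L₂`, `M₀` a pure submodule of both `L₁` and `L₂`, such that the
canonical map `(L₁ ⊕ L₂)/{(m, -m) : m ∈ M₀} → L₃`, `[(x, y)] ↦ x + y`, is a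
pure embedding (where submodules of `M₃` are identified with their images under `e`). -/
structure PureWitness (R : Type u) [Ring R] (W : Type u) [AddCommGroup W] [Module R W]
    (M₀ M₁ : Submodule R W) (D : Finset W) : Type (u + 1) where
  L : Type u
  [addL : AddCommGroup L]
  [modL : Module R L]
  e : W →ₗ[R] L
  L₁ : Submodule R L
  L₂ : Submodule R L
  /-- `M₃` is a pure submodule of `L₃` -/
  he : IsPureEmbedding e
  /-- `L₁` is a pure submodule of `L₃` -/
  hL₁ : IsPureSubmodule L₁
  /-- `L₂` is a pure submodule of `L₃` -/
  hL₂ : IsPureSubmodule L₂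
  /-- `M₁ ⊆ L₁` -/
  hM₁L₁ : M₁.map e ≤ L₁
  /-- `D ⊆ L₂` -/
  hDL₂ : ∀ d ∈ D, e d ∈ L₂
  /-- `M₀ ⊆ L₁` -/
  hM₀L₁ : M₀.map e ≤ L₁
  /-- `M₀ ⊆ L₂` -/
  hM₀L₂ : M₀.map e ≤ L₂
  /-- `M₀` is a pure submodule of `L₁` -/
  hpure₁ : IsPureSubmodule ((M₀.map e).comap L₁.subtype)
  /-- `M₀` is a pure submodule of `L₂` -/
  hpure₂ : IsPureSubmodule ((M₀.map e).comap L₂.subtype)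
  /-- the canonical map `(L₁ ⊕ L₂)/{(m, -m) : m ∈ M₀} → L₃` is a pure embedding -/
  hamalg : IsPureEmbedding (amalgMap L₁ L₂ (M₀.map e))

theorem amalgMap_range {R : Type*} [Ring R] {N : Type*} [AddCommGroup N] [Module R N]
    (P Q S : Submodule R N) (z : N) :
    z ∈ LinearMap.range (amalgMap P Q S) ↔ ∃ x ∈ P, ∃ y ∈ Q, x + y = z := by
  constructor
  · rintro ⟨w, rfl⟩
    obtain ⟨⟨x, y⟩, rfl⟩ := Submodule.Quotient.mk_surjective _ w
    exact ⟨x, x.2, y, y.2, rfl⟩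
  · rintro ⟨x, hx, y, hy, rfl⟩
    exact ⟨Submodule.Quotient.mk (⟨x, hx⟩, ⟨y, hy⟩), rfl⟩

theorem amalgMap_inj {R : Type*} [Ring R] {N : Type*} [AddCommGroup N] [Module R N]
    (P Q S : Submodule R N) :
    Function.Injective (amalgMap P Q S) ↔ ∀ x ∈ P, ∀ y ∈ Q, x + y = 0 → x ∈ S := by
  rw [injective_iff_map_eq_zero]
  constructor
  · intro h x hx y hy hxy
    have h1 := h (Submodule.Quotient.mk (⟨x, hx⟩, ⟨y, hy⟩)) hxy
    rw [Submodule.Quotient.mk_eq_zero] at h1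
    exact h1.1
  · intro h w hw
    obtain ⟨⟨x, y⟩, rfl⟩ := Submodule.Quotient.mk_surjective _ w
    have hw' : (x : N) + y = 0 := hw
    rw [Submodule.Quotient.mk_eq_zero]
    exact ⟨h x x.2 y y.2 hw', by simpa using hw'⟩

theorem pure_pull {R : Type*} [Ring R] {M N : Type*} [AddCommGroup M] [Module R M]
    [AddCommGroup N] [Module R N] {e : M →ₗ[R] N} (he : IsPureEmbedding e)
    {A : Submodule R M} (hA : IsPureSubmodule A) {m n : ℕ} (r : Fin m → Fin n → R)
    (a : Fin m → M) (ha : ∀ i, a i ∈ A) (u : Fin n → N)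
    (hu : ∀ i, (∑ j, r i j • u j) = e (a i)) :
    ∃ x : Fin n → M, (∀ j, x j ∈ A) ∧ ∀ i, (∑ j, r i j • x j) = a i := by
  obtain ⟨x, hx, hxe⟩ := he.2 m n r (fun i => e (a i)) (fun i => ⟨_, rfl⟩) ⟨u, hu⟩
  choose y hy using hx
  refine hA m n r a ha ⟨y, fun i => he.1 ?_⟩
  simp [map_sum, hy, hxe]

theorem stmt7 {R W : Type u} [Ring R] [AddCommGroup W] [Module R W]
    (M₀ M₁ M₂ : Submodule R W)
    (hM₀ : IsPureSubmodule M₀) (hM₁ : IsPureSubmodule M₁) (hM₂ : IsPureSubmodule M₂)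
    (h₀₁ : M₀ ≤ M₁) (h₀₂ : M₀ ≤ M₂)
    (hp₁ : IsPureSubmodule (M₀.comap M₁.subtype))
    (hp₂ : IsPureSubmodule (M₀.comap M₂.subtype))
    (hwit : ∀ D : Finset W, (↑D : Set W) ⊆ (M₂ : Set W) →
      Nonempty (PureWitness R W M₀ M₁ D)) :
    -- the canonical map `t : (M₁ ⊕ M₂)/{(m, -m) : m ∈ M₀} → M₃`, `[(x,y)] ↦ x + y`,
    -- is a pure embedding
    IsPureEmbedding (amalgMap M₁ M₂ M₀) := by
  classical
  constructor
  · rw [amalgMap_inj]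
    intro x hx y hy hxy
    obtain ⟨w⟩ := hwit {y} (by simpa using hy)
    obtain ⟨L, e, L₁, L₂, he, -, -, h1, h2, -, -, -, -, ham⟩ := w
    have := (amalgMap_inj _ _ _).1 ham.1 (e x) (h1 ⟨x, hx, rfl⟩) (e y) (h2 y (by simp))
      (by rw [← map_add, hxy, map_zero])
    obtain ⟨z, hz, hzx⟩ := this
    rwa [← he.1 hzx]
  · rintro m n r s hs ⟨x, hx⟩
    simp only [amalgMap_range] at hs
    choose a ha b hb hab using hs
    obtain ⟨w⟩ := hwit (Finset.univ.image b) (by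
      intro z hz
      simp only [Finset.coe_image, Finset.coe_univ, Set.image_univ] at hz
      obtain ⟨i, rfl⟩ := hz
      exact hb i)
    obtain ⟨L, e, L₁, L₂, he, -, -, h1, h2, -, -, -, -, ham⟩ := w
    obtain ⟨q, hq, hqs⟩ := ham.2 m n r (fun i => e (s i))
      (fun i => (amalgMap_range _ _ _ _).2 ⟨e (a i), h1 ⟨_, ha i, rfl⟩, e (b i),
        h2 _ (by simp), by rw [← map_add, hab]⟩)
      ⟨fun j => e (x j), fun i => by simp [← hx]⟩
    simp only [amalgMap_range] at hq
    choose u hu v hv huv using hq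
    have key : ∀ i, (∑ j, r i j • u j) + (∑ j, r i j • v j) = e (a i) + e (b i) := by
      intro i
      rw [← map_add, hab, ← hqs, ← Finset.sum_add_distrib]
      simp [← huv]
    have hc : ∀ i, ∃ c ∈ M₀, e c = (∑ j, r i j • u j) - e (a i) := by
      intro i
      refine (amalgMap_inj _ _ _).1 ham.1 _ ?_ ((∑ j, r i j • v j) - e (b i)) ?_ ?_
      · exact sub_mem (sum_mem fun j _ => L₁.smul_mem _ (hu j)) (h1 ⟨_, ha i, rfl⟩)
      · exact sub_mem (sum_mem fun j _ => L₂.smul_mem _ (hv j)) (h2 _ (by simp))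
      · have := key i
        rw [sub_add_sub_comm, this, sub_self]
    choose c hc hce using hc
    obtain ⟨y, hy, hye⟩ := pure_pull he hM₁ r (fun i => a i + c i)
      (fun i => add_mem (ha i) (h₀₁ (hc i))) u (fun i => by simp [hce])
    obtain ⟨z, hz, hze⟩ := pure_pull he hM₂ r (fun i => b i - c i)
      (fun i => sub_mem (hb i) (h₀₂ (hc i))) v (fun i => by
        have := key i
        rw [map_sub, hce, ← sub_add, ← sub_eq_zero, ← sub_eq_zero.2 this]
        abel)
    refine ⟨fun j => y j + z j, fun j => (amalgMap_range _ _ _ _).2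
      ⟨_, hy j, _, hz j, rfl⟩, fun i => ?_⟩
    simp only [smul_add, Finset.sum_add_distrib, hye, hze, ← hab]
    abel
end

section
/- Let R be a commutative ring and F a flat R-module. Then F is Σ-cotorsion (i.e., for every set I the direct sum F^{(I)} is injective relative to pure embeddings between flat R-modules) if and only if F^{(κ)} is injective relative to pure embeddings between flat R-modules. -/
universe u

/-- `M` is injective relative to pure embeddings between flat modules; for flat
`M` this says exactly that `M` is cotorsion. -/
def FlatCotorsion (R : Type u) [CommRing R] (F : Type u) [AddCommGroup F] [Module R F] : Prop :=
  ∀ (A B : Type u) [AddCommGroup A] [Module R A] [AddCommGroup B] [Module R B],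
    Module.Flat R A → Module.Flat R B →
    ∀ f : A →ₗ[R] B, IsPureEmbedding f →
    ∀ g : A →ₗ[R] F, ∃ h : B →ₗ[R] F, h.comp f = g

open Cardinal in
/-- Closing a set under a small family of finitary operations. -/
theorem exists_closed_small {B : Type u} (ι : Type u) (ar : ι → ℕ)
    (op : ∀ i, (Fin (ar i) → B) → B) :
    ∃ S : Set B, #S ≤ max #ι ℵ₀ ∧
      ∀ i (v : Fin (ar i) → B), (∀ k, v k ∈ S) → op i v ∈ S := by
  let W := WType (fun i : ι => Fin (ar i))
  let ev : W → B := WType.elim B (fun x => op x.1 x.2)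
  refine ⟨Set.range ev, ?_, ?_⟩
  · have h1 : #(Set.range ev) ≤ #W := mk_range_le
    have h2 : #W ≤ max (lift.{0} #ι) ℵ₀ := WType.cardinalMk_le_max_aleph0_of_finite'
    simpa using h1.trans h2
  · intro i v hv
    choose w hw using hv
    refine ⟨WType.mk i w, ?_⟩
    change op i (fun k => ev (w k)) = op i v
    congr 1
    funext k
    exact hw k

/-- Indices for the operations used in the Löwenheim–Skolem argument. -/
abbrev OpIdx (R : Type u) : Type u :=
  Option (Option (R ⊕ (Σ p : Fin 3 × ℕ × ℕ, (Fin p.2.1 → Fin p.2.2 → R) × Fin p.2.2)))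

open Cardinal in
theorem mk_opIdx_le (R : Type u) : #(OpIdx R) ≤ max #R ℵ₀ := by
  have hκ : ℵ₀ ≤ max #R ℵ₀ := le_max_right _ _
  have h1 : #(Σ p : Fin 3 × ℕ × ℕ, (Fin p.2.1 → Fin p.2.2 → R) × Fin p.2.2) ≤ max #R ℵ₀ := by
    rw [mk_sigma]
    refine (sum_le_sum _ (fun _ => max #R ℵ₀) ?_).trans ?_
    · rintro ⟨k, m, n⟩
      rw [mk_prod]
      simp only [lift_id, lift_uzero]
      refine mul_le_of_le hκ ?_ ?_
      · have : #(Fin m → Fin n → R) = (#R ^ (n:Cardinal)) ^ (m:Cardinal) := by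
          simp
        rw [this]
        refine power_nat_le_max.trans (max_le ?_ hκ)
        exact power_nat_le_max
      · exact (by simpa using (natCast_lt_aleph0 (n := n)).le.trans hκ)
    · rw [sum_const]
      refine mul_le_of_le hκ ?_ ?_
      · have : #(Fin 3 × ℕ × ℕ) ≤ ℵ₀ := mk_le_aleph0
        have := lift_le.{u}.2 this
        rw [lift_aleph0] at this
        exact this.trans hκ
      · simp
  have h2 : #(R ⊕ (Σ p : Fin 3 × ℕ × ℕ, (Fin p.2.1 → Fin p.2.2 → R) × Fin p.2.2))
      ≤ max #R ℵ₀ := by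
    rw [mk_sum]
    simp only [lift_id, lift_uzero]
    exact add_le_of_le hκ (le_max_left _ _) h1
  have one : (1 : Cardinal.{u}) ≤ max #R ℵ₀ := one_le_aleph0.trans hκ
  rw [mk_option, mk_option]
  exact add_le_of_le hκ (add_le_of_le hκ h2 one) one

/-- Skolem predicates. -/
def SysSol {R : Type u} [CommRing R] {B : Type u} [AddCommGroup B] [Module R B]
    (A : Submodule R B) (k : Fin 3) {m n : ℕ} (r : Fin m → Fin n → R) (c : Fin m → B)
    (x : Fin n → B) : Prop :=
  match k with
  | 0 => ∀ i, ∑ j, r i j • x j = c i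
  | 1 => (∀ i, ∑ j, r i j • x j = c i) ∧ ∀ j, x j ∈ A
  | 2 => ∀ i, (∑ j, r i j • x j) - c i ∈ A

open Cardinal in
theorem exists_small_pure {R : Type u} [CommRing R] {B : Type u} [AddCommGroup B] [Module R B]
    (A : Submodule R B) (hA : IsPureSubmodule A) (b : B) :
    ∃ C : Submodule R B, b ∈ C ∧ #C ≤ max #R ℵ₀ ∧ IsPureSubmodule C ∧
      IsPureSubmodule (A.comap C.subtype) ∧ IsPureSubmodule (A ⊔ C) := by
  classical
  let ar : OpIdx R → ℕ := fun i => match i with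
    | none => 0
    | some none => 2
    | some (some (Sum.inl _)) => 1
    | some (some (Sum.inr ⟨p, _⟩)) => p.2.1
  let op : ∀ i, (Fin (ar i) → B) → B := fun i => match i with
    | none => fun _ => b
    | some none => fun v : Fin 2 → B => v 0 + v 1
    | some (some (Sum.inl r)) => fun v : Fin 1 → B => r • v 0
    | some (some (Sum.inr ⟨p, q⟩)) => fun v : Fin p.2.1 → B =>
        if h : ∃ x, SysSol A p.1 q.1 v x then h.choose q.2 else 0
  obtain ⟨S, hS, hcl⟩ := exists_closed_small (OpIdx R) ar op
  have hb : b ∈ S := hcl none Fin.elim0 (fun k => k.elim0)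
  have hadd : ∀ x y, x ∈ S → y ∈ S → x + y ∈ S := fun x y hx hy =>
    hcl (some none) ![x, y] (fun k => by
      change Fin 2 at k
      fin_cases k
      · exact hx
      · exact hy)
  have hsmul : ∀ (r : R) x, x ∈ S → r • x ∈ S := fun r x hx =>
    hcl (some (some (Sum.inl r))) (fun _ => x) (fun _ => hx)
  have hsys : ∀ (k : Fin 3) (m n : ℕ) (r : Fin m → Fin n → R) (c : Fin m → B),
      (∀ i, c i ∈ S) → (∃ x, SysSol A k r c x) → ∃ x, SysSol A k r c x ∧ ∀ j, x j ∈ S := by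
    intro k m n r c hc h
    refine ⟨h.choose, h.choose_spec, fun j => ?_⟩
    have := hcl (some (some (Sum.inr ⟨(k, m, n), (r, j)⟩))) c hc
    change (if h : ∃ x, SysSol A k r c x then h.choose j else 0) ∈ S at this
    rwa [dif_pos h] at this
  let C : Submodule R B :=
    { carrier := S
      add_mem' := fun {x y} hx hy => hadd x y hx hy
      zero_mem' := by simpa using hsmul 0 b hb
      smul_mem' := fun r x hx => hsmul r x hx }
  have hCS : ∀ x, x ∈ C ↔ x ∈ S := fun x => Iff.rfl
  refine ⟨C, hb, ?_, ?_, ?_, ?_⟩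
  · exact hS.trans (max_le (mk_opIdx_le R) (le_max_right _ _))
  · intro m n r a ha hx
    obtain ⟨x, hx, hxS⟩ := hsys 0 m n r a ha hx
    exact ⟨x, hxS, hx⟩
  · intro m n r a ha hx
    obtain ⟨x, hx⟩ := hx
    obtain ⟨y, hyA, hy⟩ := hA m n r (fun i => (a i : B)) ha
      ⟨fun j => (x j : B), fun i => by rw [← hx i]; simp⟩
    obtain ⟨z, ⟨hz, hzA⟩, hzS⟩ := hsys 1 m n r (fun i => (a i : B)) (fun i => (a i).2) ⟨y, hy, hyA⟩
    refine ⟨fun j => ⟨z j, hzS j⟩, hzA, fun i => Subtype.ext ?_⟩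
    refine Eq.trans ?_ (hz i)
    simp
  · intro m n r a ha hx
    obtain ⟨x, hx⟩ := hx
    choose a' ha' c hc hac using fun i => Submodule.mem_sup.1 (ha i)
    obtain ⟨y, hy, hyS⟩ := hsys 2 m n r c hc ⟨x, fun i => by
      rw [hx i, ← hac i]; simpa using ha' i⟩
    obtain ⟨z, hzA, hz⟩ := hA m n r (fun i => a' i - ((∑ j, r i j • y j) - c i))
      (fun i => A.sub_mem (ha' i) (hy i))
      ⟨fun j => x j - y j, fun i => by
        simp only [smul_sub, Finset.sum_sub_distrib, hx i, ← hac i]; abel⟩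
    refine ⟨fun j => z j + y j, fun j => Submodule.add_mem_sup (hzA j) (hyS j), fun i => ?_⟩
    simp only [smul_add, Finset.sum_add_distrib, hz i, ← hac i]
    abel

theorem flat_of_pure {R : Type u} [CommRing R] {B : Type u} [AddCommGroup B] [Module R B]
    (hB : Module.Flat R B) (A : Submodule R B) (hA : IsPureSubmodule A) : Module.Flat R A := by
  rw [Module.Flat.iff_forall_isTrivialRelation] at hB ⊢
  intro l f x hx
  obtain ⟨k, a, y, hy, ha⟩ := hB (l := l) (f := f) (x := fun i => (x i : B)) (by
    have := congrArg A.subtype hx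
    simpa using this)
  obtain ⟨z, hzA, hz⟩ := hA l k a (fun i => (x i : B)) (fun i => (x i).2) ⟨y, fun i => (hy i).symm⟩
  refine ⟨k, a, fun j => ⟨z j, hzA j⟩, fun i => Subtype.ext ?_, ha⟩
  rw [← hz i]; simp

open Cardinal in
theorem flatCotorsion_of_small {R : Type u} [CommRing R] {M : Type u} [AddCommGroup M]
    [Module R M]
    (H : ∀ (C : Type u) [AddCommGroup C] [Module R C], Module.Flat R C → #C ≤ max #R ℵ₀ →
      ∀ D : Submodule R C, IsPureSubmodule D → ∀ g : D →ₗ[R] M,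
        ∃ h : C →ₗ[R] M, ∀ d : D, h d = g d) : FlatCotorsion R M := by
  intro A B _ _ _ _ hA hB f hf g
  let e := LinearEquiv.ofInjective f hf.1
  let p0 : B →ₗ.[R] M := ⟨LinearMap.range f, g.comp e.symm.toLinearMap⟩
  obtain ⟨p, hp0, hp⟩ := zorn_le_nonempty₀ {p : B →ₗ.[R] M | IsPureSubmodule p.domain} (by
    intro c hc hchain y hy
    refine ⟨LinearPMap.sSup c hchain.directedOn, ?_, fun z hz => LinearPMap.le_sSup _ hz⟩
    intro m n r a ha hx
    simp only [LinearPMap.mem_domain_sSup_iff ⟨y, hy⟩] at ha ⊢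
    choose q hq hqa using ha
    have : ∃ q0 ∈ c, ∀ i, q i ≤ q0 := by
      obtain ⟨q0, h0, h1⟩ : ∃ q0 ∈ c, ∀ i ∈ (Finset.univ : Finset (Fin m)), q i ≤ q0 := by
        generalize (Finset.univ : Finset (Fin m)) = s
        induction s using Finset.induction_on with
        | empty => exact ⟨y, hy, by simp⟩
        | insert i s _ ih =>
          obtain ⟨q1, h1, h2⟩ := ih
          obtain ⟨q2, h3, h4, h5⟩ := hchain.directedOn q1 h1 (q i) (hq i)
          refine ⟨q2, h3, fun j hj => ?_⟩
          rcases Finset.mem_insert.1 hj with rfl | hj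
          · exact h5
          · exact (h2 j hj).trans h4
      exact ⟨q0, h0, fun i => h1 i (Finset.mem_univ i)⟩
    obtain ⟨q0, h0, hle⟩ := this
    obtain ⟨x, hx1, hx2⟩ := hc h0 m n r a (fun i => (hle i).1 (hqa i)) hx
    exact ⟨x, fun j => ⟨q0, h0, hx1 j⟩, hx2⟩) p0 hf.2
  have hpp : IsPureSubmodule p.domain := hp.prop
  have htop : ∀ b, b ∈ p.domain := by
    intro b
    obtain ⟨C, hbC, hcard, hC, hD, hsup⟩ := exists_small_pure p.domain hpp b
    let D := p.domain.comap C.subtype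
    let gD : D →ₗ[R] M := p.toFun.comp
      (LinearMap.codRestrict p.domain (C.subtype.comp D.subtype) (fun d => d.2))
    obtain ⟨h, hh⟩ := H C (flat_of_pure hB C hC) hcard D hD gD
    let q : B →ₗ.[R] M := ⟨C, h⟩
    have agree : ∀ (x : p.domain) (y : q.domain), (x : B) = y → p x = q y := by
      intro x y hxy
      have hyD : (y : C) ∈ D := by
        change (y : B) ∈ p.domain
        rw [← hxy]; exact x.2
      have h1 := hh ⟨y, hyD⟩
      change p x = h y
      refine Eq.trans ?_ h1.symm
      change p x = p ⟨(y : B), _⟩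
      congr 1
      exact Subtype.ext hxy
    have hle := hp.le_of_ge (y := p.sup q agree) hsup (LinearPMap.left_le_sup _ _ _)
    exact hle.1 (Submodule.mem_sup_right hbC)
  refine ⟨p.toFun.comp (LinearMap.codRestrict p.domain LinearMap.id htop), ?_⟩
  ext a
  have h2 := hp0.2 (x := ⟨f a, ⟨a, rfl⟩⟩) (y := ⟨f a, htop _⟩) rfl
  refine Eq.trans h2.symm ?_
  change g (e.symm ⟨f a, _⟩) = g a
  congr 1
  rw [LinearEquiv.symm_apply_eq]
  rfl

open Cardinal in
theorem stmt15 (R : Type u) [CommRing R] (F : Type u) [AddCommGroup F] [Module R F]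
    (hF : Module.Flat R F)
    (J : Type u) (hJ : Cardinal.mk J = max (Cardinal.mk R) Cardinal.aleph0) :
    -- `F` is Σ-cotorsion, i.e. `F^(I)` is injective relative to pure embeddings
    -- between flat modules for every set `I`, iff `F^(κ)` is, where `κ = card R + ℵ₀`
    (∀ I : Type u, FlatCotorsion R (DirectSum I fun _ => F)) ↔
      FlatCotorsion R (DirectSum J fun _ => F) := by
  classical
  refine ⟨fun h => h J, fun hJF I => flatCotorsion_of_small ?_⟩
  intro C _ _ hC hcard D hD g
  have hκ : ℵ₀ ≤ max #R ℵ₀ := le_max_right _ _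
  let eI := finsuppLEquivDirectSum R F I
  let eJ := finsuppLEquivDirectSum R F J
  let g' : D →ₗ[R] (I →₀ F) := eI.symm.toLinearMap.comp g
  let I' : Set I := ⋃ d : D, ((g' d).support : Set I)
  have hDcard : #D ≤ max #R ℵ₀ := (mk_le_of_injective Subtype.val_injective).trans hcard
  have hI' : #I' ≤ #J := by
    rw [hJ]
    refine mk_iUnion_le_sum_mk.trans ((sum_le_sum _ (fun _ => ℵ₀) ?_).trans ?_)
    · intro d
      exact mk_le_aleph0
    · rw [sum_const']
      exact mul_le_of_le hκ hDcard hκ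
  obtain ⟨ε⟩ : Nonempty (I' ↪ J) := hI'
  let α : (I →₀ F) →ₗ[R] (J →₀ F) :=
    (Finsupp.lmapDomain F R ε).comp (Finsupp.lsubtypeDomain I')
  let β : (J →₀ F) →ₗ[R] (I →₀ F) :=
    (Finsupp.lmapDomain F R (Subtype.val : I' → I)).comp (Finsupp.lcomapDomain ε ε.injective)
  have hβα : ∀ d, β (α (g' d)) = g' d := by
    intro d
    change Finsupp.mapDomain Subtype.val (Finsupp.comapDomain ε (Finsupp.mapDomain ε
      (Finsupp.subtypeDomain (fun x => x ∈ I') (g' d))) ε.injective.injOn) = g' d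
    rw [Finsupp.comapDomain_mapDomain _ ε.injective]
    ext i
    by_cases hi : i ∈ I'
    · have := Finsupp.mapDomain_apply (Subtype.val_injective (p := fun x => x ∈ I'))
        (Finsupp.subtypeDomain (fun x => x ∈ I') (g' d)) ⟨i, hi⟩
      exact this
    · rw [Finsupp.mapDomain_notin_range _ _ (by simpa using hi)]
      by_contra hne
      exact hi (Set.mem_iUnion.2 ⟨d, by simpa using Ne.symm hne⟩)
  obtain ⟨h, hh⟩ := hJF D C (flat_of_pure hC D hD) hC D.subtype
    ⟨Subtype.val_injective, by rw [Submodule.range_subtype]; exact hD⟩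
    (eJ.toLinearMap.comp (α.comp g'))
  refine ⟨eI.toLinearMap.comp (β.comp (eJ.symm.toLinearMap.comp h)), fun d => ?_⟩
  have h1 : h d = eJ (α (g' d)) := LinearMap.congr_fun hh d
  change eI (β (eJ.symm (h d))) = g d
  rw [h1, LinearEquiv.symm_apply_apply, hβα]
  exact eI.apply_symm_apply _
end
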